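/- Let K, σ, T > 0, r ≥ 0, 0 ≤ t < T and s > 0. With d₁ = (log(s/K) + (r + σ²/2)(T−t))/(σ√(T−t)) and d₂ = d₁ − σ√(T−t), the Black–Scholes call price satisfies the strict inequality s·Φ(d₁) − K·e^{−r(T−t)}·Φ(d₂) > max(s − K, 0). Consequently, before maturity the value of the call strictly exceeds the payoff from immediate exercise, so it is never optimal to exercise early an American call option on a non-dividend-paying asset, and the American and European call prices coincide. -/

import Mathlib

open Real MeasureTheory

/-- The standard normal cumulative distribution function. -/
noncomputable def Phi (x : ℝ) : ℝ :=
  (Real.sqrt (2 * Real.pi))⁻¹ * ∫ y in Set.Iio x, Real.exp (-(y ^ 2) / 2)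

lemma integrable_exp_neg_sq_div_two : Integrable fun y : ℝ => Real.exp (-(y ^ 2) / 2) := by
  convert integrable_exp_neg_mul_sq (b := 1 / 2) (by norm_num) using 3
  ring

lemma integral_exp_neg_sq_div_two :
    ∫ y : ℝ, Real.exp (-(y ^ 2) / 2) = Real.sqrt (2 * Real.pi) := by
  have h := integral_gaussian (1 / 2)
  rw [show Real.pi / (1 / 2) = 2 * Real.pi by ring] at h
  rw [← h]
  congr 1 with y
  ring_nf

lemma setIntegral_Iio_comp_add_right (f : ℝ → ℝ) (a v : ℝ) :
    ∫ y in Set.Iio a, f (y + v) = ∫ y in Set.Iio (a + v), f y := by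
  have h := (measurePreserving_add_right volume v).setIntegral_preimage_emb
    (measurableEmbedding_addRight v) f (Set.Iio (a + v))
  simpa using h

lemma setIntegral_pos_of_forall_pos {f : ℝ → ℝ} {S : Set ℝ} (hS : MeasurableSet S)
    (hvol : volume S ≠ 0) (hf : IntegrableOn f S) (hpos : ∀ y ∈ S, 0 < f y) :
    0 < ∫ y in S, f y := by
  rw [setIntegral_pos_iff_support_of_nonneg_ae
    (ae_restrict_of_forall_mem hS fun y hy => (hpos y hy).le) hf]
  rw [Set.inter_eq_right.mpr fun y hy => Function.mem_support.mpr (hpos y hy).ne']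
  exact pos_iff_ne_zero.mpr hvol

/-- The Black–Scholes price, written with the discounted strike `k` and total volatility `v`,
lies strictly above `max (s - k) 0`. -/
lemma max_sub_zero_lt_mul_Phi_sub_mul_Phi {k v a : ℝ} (hk : 0 < k) (hv : 0 < v) :
    max (k * Real.exp (a * v + v ^ 2 / 2) - k) 0 <
      k * Real.exp (a * v + v ^ 2 / 2) * Phi (a + v) - k * Phi a := by
  set s := k * Real.exp (a * v + v ^ 2 / 2) with hs
  set g : ℝ → ℝ := fun y => s * Real.exp (-((y + v) ^ 2) / 2) - k * Real.exp (-(y ^ 2) / 2)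
    with hg
  have hshift : Integrable fun y : ℝ => s * Real.exp (-((y + v) ^ 2) / 2) :=
    (integrable_exp_neg_sq_div_two.comp_add_right v).const_mul s
  have hbase : Integrable fun y : ℝ => k * Real.exp (-(y ^ 2) / 2) :=
    integrable_exp_neg_sq_div_two.const_mul k
  have hint : Integrable g := hshift.sub hbase
  have hfactor (y : ℝ) : g y = k * Real.exp (-(y ^ 2) / 2) * (Real.exp (v * (a - y)) - 1) := by
    simp only [hg, hs]
    rw [mul_sub, mul_one, mul_assoc, mul_assoc, ← Real.exp_add, ← Real.exp_add]
    ring_nf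
  have hlower : 0 < ∫ y in Set.Iio a, g y := by
    refine setIntegral_pos_of_forall_pos measurableSet_Iio (by simp) hint.integrableOn ?_
    intro y hy
    rw [hfactor]
    have : 1 < Real.exp (v * (a - y)) := Real.one_lt_exp_iff.mpr (mul_pos hv (sub_pos.mpr hy))
    exact mul_pos (by positivity) (sub_pos.mpr this)
  have hupper : 0 < ∫ y in Set.Ioi a, -g y := by
    refine setIntegral_pos_of_forall_pos measurableSet_Ioi (by simp) hint.neg.integrableOn ?_
    intro y hy
    rw [hfactor, ← mul_neg, neg_sub]
    have : Real.exp (v * (a - y)) < 1 :=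
      Real.exp_lt_one_iff.mpr (mul_neg_of_pos_of_neg hv (sub_neg.mpr hy))
    exact mul_pos (by positivity) (sub_pos.mpr this)
  have hsplit : (∫ y in Set.Iio a, g y) + ∫ y in Set.Ioi a, g y = ∫ y, g y := by
    rw [← integral_Ici_eq_integral_Ioi, ← Set.compl_Iio]
    exact integral_add_compl measurableSet_Iio hint
  have htotal : ∫ y, g y = (s - k) * Real.sqrt (2 * Real.pi) := by
    rw [integral_sub hshift hbase, integral_const_mul, integral_const_mul,
      integral_add_right_eq_self (fun y : ℝ => Real.exp (-(y ^ 2) / 2)),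
      integral_exp_neg_sq_div_two]
    ring
  have hc : 0 < Real.sqrt (2 * Real.pi) := by positivity
  have hprice : s * Phi (a + v) - k * Phi a =
      (Real.sqrt (2 * Real.pi))⁻¹ * ∫ y in Set.Iio a, g y := by
    rw [integral_sub hshift.integrableOn hbase.integrableOn, integral_const_mul,
      integral_const_mul,
      setIntegral_Iio_comp_add_right (fun y : ℝ => Real.exp (-(y ^ 2) / 2)), Phi, Phi]
    ring
  rw [integral_neg] at hupper
  rw [hprice]
  refine max_lt ?_ (by positivity)
  rw [inv_mul_eq_div, lt_div_iff₀ hc]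
  linarith

/-- Before maturity, the Black–Scholes call price strictly exceeds the intrinsic value
`max(s − K, 0)`, so early exercise of an American call on a non-dividend-paying asset
is never optimal. -/
theorem black_scholes_call_exceeds_intrinsic_value
    (K σ T r t s : ℝ) (hK : 0 < K) (hσ : 0 < σ) (hT : 0 < T) (hr : 0 ≤ r)
    (ht₀ : 0 ≤ t) (ht : t < T) (hs : 0 < s)
    (d₁ d₂ : ℝ)
    (hd₁ : d₁ = (Real.log (s / K) + (r + σ ^ 2 / 2) * (T - t)) / (σ * Real.sqrt (T - t)))
    (hd₂ : d₂ = d₁ - σ * Real.sqrt (T - t)) :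
    max (s - K) 0 < s * Phi d₁ - K * Real.exp (-r * (T - t)) * Phi d₂ := by
  have hτ : 0 < T - t := sub_pos.mpr ht
  have hv : 0 < σ * Real.sqrt (T - t) := by positivity
  have hsq : (σ * Real.sqrt (T - t)) ^ 2 = σ ^ 2 * (T - t) := by
    rw [mul_pow, Real.sq_sqrt hτ.le]
  have hlog : d₁ * (σ * Real.sqrt (T - t)) =
      Real.log (s / K) + (r + σ ^ 2 / 2) * (T - t) := by
    rw [hd₁, div_mul_cancel₀ _ hv.ne']
  generalize σ * Real.sqrt (T - t) = v at *
  have hspot : K * Real.exp (-r * (T - t)) * Real.exp (d₂ * v + v ^ 2 / 2) = s := by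
    have hexponent : -r * (T - t) + (d₂ * v + v ^ 2 / 2) = Real.log (s / K) := by
      rw [hd₂]
      linarith
    rw [mul_assoc, ← Real.exp_add, hexponent, Real.exp_log (div_pos hs hK),
      mul_div_cancel₀ _ hK.ne']
  have hmain := max_sub_zero_lt_mul_Phi_sub_mul_Phi (k := K * Real.exp (-r * (T - t)))
    (a := d₂) (by positivity) hv
  rw [hspot, show d₂ + v = d₁ by rw [hd₂]; ring] at hmain
  refine lt_of_le_of_lt (max_le_max_right 0 (sub_le_sub_left ?_ s)) hmain
  refine mul_le_of_le_one_right hK.le (Real.exp_le_one_iff.mpr ?_)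
  exact mul_nonpos_of_nonpos_of_nonneg (neg_nonpos.mpr hr) hτ.le
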